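/- arXiv:2204.04630 — 2 statements merged into one kernel-verified Lean document; each statement's English description precedes it below -/
import Mathlib

section
/- Let m be a positive integer, r a positive real, and x a real number with −1 ≤ x < 1. Then every real root λ of the quadratic Q_{m,r,x}(λ) = (mr+1)(m+1)λ^2 − [(m−1)(mr+1)+(m+1)x]λ − [mr+(mr+1−m)x] satisfies −1 < λ < 1. -/
/-- for `−1 ≤ x < 1`, every real root of `Q_{m,r,x}` lies in `(−1, 1)`. -/
theorem stmt_10 (m : ℕ) (hm : 0 < m) (r : ℝ) (hr : 0 < r)
    (x : ℝ) (hx1 : -1 ≤ x) (hx2 : x < 1) (lam : ℝ)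
    (hroot : ((m : ℝ) * r + 1) * ((m : ℝ) + 1) * lam ^ 2
        - (((m : ℝ) - 1) * ((m : ℝ) * r + 1) + ((m : ℝ) + 1) * x) * lam
        - ((m : ℝ) * r + ((m : ℝ) * r + 1 - (m : ℝ)) * x) = 0) :
    -1 < lam ∧ lam < 1 := by
  have hM : (1 : ℝ) ≤ m := by exact_mod_cast hm
  have ha : 0 < (m : ℝ) * r := by positivity
  generalize (m : ℝ) = M at *
  generalize M * r = a at *
  have hA : 0 < (a + 1) * (M + 1) := by positivity
  constructor
  · by_contra! h
    have hval : 0 < 2 * (a + 1) * M - a + (2 * M - a) * x := by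
      nlinarith [mul_nonneg (sub_nonneg.2 hM) ha.le]
    have hslope : 0 ≤ (a + 1) * (3 * M + 1) + (M + 1) * x := by nlinarith
    nlinarith [mul_nonneg (by linarith : 0 ≤ -1 - lam) hslope,
      mul_nonneg hA.le (sq_nonneg (lam + 1))]
  · by_contra! h
    have hval : 0 < (a + 2) * (1 - x) := mul_pos (by linarith) (by linarith)
    have hslope : 0 ≤ (a + 1) * (M + 3) - (M + 1) * x := by nlinarith
    nlinarith [mul_nonneg (by linarith : 0 ≤ lam - 1) hslope,
      mul_nonneg hA.le (sq_nonneg (lam - 1))]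
end

section
/- Let m be a positive integer, r a positive real, and y a real number with 0 < y ≤ 2. Then every real root σ of the quadratic R_{m,r,y}(σ) = (mr+1)(m+1)σ^2 − [(m+1)y + mr(m+3)+2]σ + (mr+2)y satisfies 0 < σ < 2. -/
/-- for `0 < y ≤ 2`, every real root of `R_{m,r,y}` lies in `(0, 2)`. -/
theorem stmt_11 (m : ℕ) (hm : 0 < m) (r : ℝ) (hr : 0 < r)
    (y : ℝ) (hy1 : 0 < y) (hy2 : y ≤ 2) (σ : ℝ)
    (hroot : ((m : ℝ) * r + 1) * ((m : ℝ) + 1) * σ ^ 2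
        - (((m : ℝ) + 1) * y + (m : ℝ) * r * ((m : ℝ) + 3) + 2) * σ
        + ((m : ℝ) * r + 2) * y = 0) :
    0 < σ ∧ σ < 2 := by
  have hm1 : (1 : ℝ) ≤ m := by exact_mod_cast hm
  have ha : 0 < (m : ℝ) * r := by positivity
  generalize (m : ℝ) * r = a at ha hroot
  generalize (m : ℝ) = n at hm1 hroot
  have hn : 0 < n := by linarith
  constructor
  · by_contra! hσ
    have h1 : 0 ≤ (a + 1) * (n + 1) * σ ^ 2 := by positivity
    have h2 : 0 ≤ ((n + 1) * y + a * (n + 3) + 2) * -σ :=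
      mul_nonneg (by positivity) (by linarith)
    have h3 : 0 < (a + 2) * y := by positivity
    linarith
  · by_contra! hσ
    obtain ⟨s, hs, rfl⟩ : ∃ s, 0 ≤ s ∧ σ = s + 2 := ⟨σ - 2, by linarith, by ring⟩
    -- The quadratic is affine in `y` and nonnegative on `[2, ∞)` at `y = 0`, positive at `y = 2`.
    have h0 : 0 ≤ (2 - y) * ((s + 2) * ((a + 1) * (n + 1) * s + a * (n - 1) + 2 * n)) := by
      have : 0 ≤ n - 1 := by linarith
      have : 0 ≤ 2 - y := by linarith
      positivity
    have h2 : 0 < y * ((a + 1) * (n + 1) * s ^ 2 + (3 * a * n + a + 2 * n) * s + 2 * a * n) := by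
      positivity
    linarith
end
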